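/- The SDE costs satisfy the general assumptions: Define φ(ω,v) := ∫₀^T φ̃(t, (𝓘^v(ω))_t) dt + ψ((𝓘^v(ω))_T) and c(ω,(t_i,b_i)_{i=1}^j) := ℓ(t_j, (𝓘^{(t_i,b_i)_{i=1}^{j−1}}(ω))_{t_j}, b_j). Then φ and c satisfy Assumption 3 of the paper: they are uniformly bounded, for each κ uniformly continuous on Ω×D^κ with respect to d_κ (with explicit moduli built from ρ_{φ̃}, ρ_ψ, ρ_ℓ and the SDE stability modulus ρ_{X,k}), c ≥ δ > 0 and c((t_i,b_i)_{i=1}^j) is F_{t_j}-measurable. -/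

import Mathlib

/- Common framework for "Non-Markovian Impulse Control Under Nonlinear Expectation"
   (M. Perninge).  Sample space, filtration, impulse controls, nonlinear
   expectations, value functions and the standing Assumptions 1-5 of the paper. -/

open MeasureTheory Set

noncomputable section

abbrev Rd (d : ℕ) := EuclideanSpace ℝ (Fin d)

/-- The sample space `Ω := {ω ∈ C(ℝ → ℝ^d) : ω 0 = 0}` of continuous paths started at `0`. -/
structure PathSpace (d : ℕ) where
  toFun : ℝ → Rd d
  continuous_toFun : Continuous toFun
  init : toFun 0 = 0

namespace PathSpace

variable {d : ℕ}

instance : CoeFun (PathSpace d) fun _ => ℝ → Rd d := ⟨PathSpace.toFun⟩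

instance : TopologicalSpace (PathSpace d) :=
  TopologicalSpace.induced PathSpace.toFun inferInstance

instance : MeasurableSpace (PathSpace d) := borel (PathSpace d)

instance : BorelSpace (PathSpace d) := ⟨rfl⟩

/-- The constant path at the origin. -/
def zero (d : ℕ) : PathSpace d := ⟨fun _ => 0, continuous_const, rfl⟩

end PathSpace

/-- Concatenation of paths `ω ⊗_r ω'` at time `r`. -/
def concatAt {d : ℕ} (ω ω' : PathSpace d) (r : ℝ) : PathSpace d where
  toFun s := if s ≤ max r 0 then ω.toFun s else ω.toFun (max r 0) + ω'.toFun (s - max r 0)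
  continuous_toFun := by
    refine Continuous.if_le ω.continuous_toFun ?_ continuous_id continuous_const ?_
    · exact continuous_const.add (ω'.continuous_toFun.comp (continuous_id.sub continuous_const))
    · intro s hs
      rw [hs, sub_self, ω'.init, add_zero]
  init := by
    have h : (0 : ℝ) ≤ max r 0 := le_max_right r 0
    simp only [h, if_true, if_pos, PathSpace.init]

/-- Supremum of a function over a set of times. -/
def supOn (S : Set ℝ) (f : ℝ → ℝ) : ℝ := sSup (f '' S)

/-- The distance `𝐝_Λ[(t,ω),(t',ω')] = |t'-t| + ‖ω'_{·∧t'} - ω_{·∧t}‖_T` on `Λ = [0,T]×Ω`. -/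
def dLambda {d : ℕ} (T : ℝ) (p q : ℝ × PathSpace d) : ℝ :=
  |q.1 - p.1| + supOn (Icc 0 T) fun s => ‖q.2.toFun (min s q.1) - p.2.toFun (min s p.1)‖

/-- `j`-th intervention time of a (deterministic) impulse sequence. -/
def entryT {d : ℕ} (v : List (ℝ × Rd d)) (j : ℕ) : ℝ := (v.getD j (0, 0)).1

/-- `j`-th impulse of a (deterministic) impulse sequence. -/
def entryB {d : ℕ} (v : List (ℝ × Rd d)) (j : ℕ) : Rd d := (v.getD j (0, 0)).2

/-- The distance `|v' - v|` between two impulse sequences. -/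
def seqDist {d : ℕ} (v v' : List (ℝ × Rd d)) : ℝ :=
  ∑ j ∈ Finset.range (max v.length v'.length),
    (|entryT v' j - entryT v j| + ‖entryB v' j - entryB v j‖)

/-- The pseudo-distance `𝐝_κ` on `Λ × D^κ`. -/
def dK {d : ℕ} (T : ℝ) (p q : ℝ × PathSpace d × List (ℝ × Rd d)) : ℝ :=
  supOn (Icc 0 T) (fun s => ‖q.2.1.toFun (min s q.1) - p.2.1.toFun (min s p.1)‖)
    + ∑ j ∈ Finset.range p.2.2.length,
        supOn (Icc 0 T) (fun s =>
          ‖q.2.1.toFun (min s (min (entryT q.2.2 j) q.1))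
            - p.2.1.toFun (min s (min (entryT p.2.2 j) p.1))‖)
    + seqDist p.2.2 q.2.2

/-- Membership in `D^κ ⊂ 𝓓`: ordered intervention times in `[0,T]` and impulses in `U`. -/
def InD {d : ℕ} (T : ℝ) (U : Set (Rd d)) (v : List (ℝ × Rd d)) : Prop :=
  v.Chain' (fun p q => p.1 ≤ q.1) ∧ ∀ p ∈ v, p.1 ∈ Icc (0 : ℝ) T ∧ p.2 ∈ U

/-- Time of the last intervention of a deterministic impulse sequence (`0` if there is none). -/
def lastTime {d : ℕ} (v : List (ℝ × Rd d)) : ℝ := (v.map Prod.fst).foldr max 0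

/-- Concatenation `v ∘ v'` of impulse sequences (later times are pushed above `lastTime v`). -/
def seqConcat {d : ℕ} (v w : List (ℝ × Rd d)) : List (ℝ × Rd d) :=
  v ++ w.map fun p => (max p.1 (lastTime v), p.2)

/-- The raw filtration `F_t` generated by the canonical process up to time `t`. -/
def Filt (d : ℕ) (t : ℝ) : MeasurableSpace (PathSpace d) :=
  MeasurableSpace.comap (fun ω : PathSpace d => fun s : ℝ => ω.toFun (min s t)) inferInstance

/-- The σ-algebra `F_τ` associated with a random time `τ`. -/
def FiltStop (d : ℕ) (τ : PathSpace d → ℝ) : MeasurableSpace (PathSpace d) :=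
  MeasurableSpace.generateFrom
    {A | ∀ t : ℝ, MeasurableSet[Filt d t] (A ∩ {ω | τ ω ≤ t})}

/-- An `𝔽`-stopping time with values in `[0,T]`. -/
structure StoppingTime (d : ℕ) (T : ℝ) where
  toFun : PathSpace d → ℝ
  mem_Icc : ∀ ω, toFun ω ∈ Icc (0 : ℝ) T
  adapted : ∀ t : ℝ, MeasurableSet[Filt d t] {ω | toFun ω ≤ t}

/-- The set `𝓣_t` of stopping times that are `≥ t`. -/
def stopAfter (d : ℕ) (T t : ℝ) : Set (StoppingTime d T) := {τ | ∀ ω, t ≤ τ.toFun ω}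

/-- The set `𝓣^t` of stopping times `≥ t` that are independent of `ω|_{[0,t]}`. -/
def stopAfterIndep (d : ℕ) (T t : ℝ) : Set (StoppingTime d T) :=
  {τ | (∀ ω, t ≤ τ.toFun ω) ∧
    ∀ ω ω' : PathSpace d,
      (∀ s, t ≤ s → ω.toFun s - ω.toFun t = ω'.toFun s - ω'.toFun t) →
        τ.toFun ω = τ.toFun ω'}

/-- The data of an impulse control `u = (τ_j, β_j)_{j ≥ 1}` (0-indexed). -/
structure Ctrl (d : ℕ) where
  τ : ℕ → PathSpace d → ℝ
  β : ℕ → PathSpace d → Rd d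

namespace Ctrl

variable {d : ℕ}

/-- `u ∈ 𝓤`: nondecreasing `[0,T]`-valued stopping times `τ_j`, `F_{τ_j}`-measurable
`U`-valued impulses `β_j`, and finitely many interventions on each path. -/
structure Valid (T : ℝ) (U : Set (Rd d)) (u : Ctrl d) : Prop where
  mono : ∀ ω j, u.τ j ω ≤ u.τ (j + 1) ω
  mem_Icc : ∀ j ω, u.τ j ω ∈ Icc (0 : ℝ) T
  adapted : ∀ (j) (t : ℝ), MeasurableSet[Filt d t] {ω | u.τ j ω ≤ t}
  beta_mem : ∀ j ω, u.β j ω ∈ U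
  beta_meas : ∀ j, Measurable[FiltStop d (u.τ j)] (u.β j)
  finite : ∀ ω, ∃ k, T ≤ u.τ k ω

/-- `u ∈ 𝓤_t` : no intervention before time `t`. -/
def startsAfter (u : Ctrl d) (t : ℝ) : Prop := ∀ ω, t ≤ u.τ 0 ω

/-- `u ∈ 𝓤^k` : at most `k` interventions, i.e. `N ≤ k`. -/
def atMost (u : Ctrl d) (T : ℝ) (k : ℕ) : Prop := ∀ ω, T ≤ u.τ k ω

/-- The truncated control `[u]_k`. -/
def trunc (u : Ctrl d) (T : ℝ) (k : ℕ) : Ctrl d where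
  τ j ω := if j < k then u.τ j ω else T
  β j ω := u.β j ω

/-- The realized sequence `(τ_i(ω), β_i(ω))_{i=1}^k` of the first `k` interventions. -/
def seq (u : Ctrl d) (k : ℕ) (ω : PathSpace d) : List (ℝ × Rd d) :=
  (List.range k).map fun j => (u.τ j ω, u.β j ω)

/-- The number `N(ω)` of interventions strictly before `T`. -/
def Nval (u : Ctrl d) (T : ℝ) (ω : PathSpace d) : ℕ := sInf {k | T ≤ u.τ k ω}

/-- The time of the last intervention (`0` if there is none). -/
def lastTau (u : Ctrl d) (T : ℝ) (ω : PathSpace d) : ℝ :=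
  if u.Nval T ω = 0 then 0 else u.τ (u.Nval T ω - 1) ω

/-- Prepending a deterministic impulse sequence to a control: `v ∘ u`. -/
def prepend (v : List (ℝ × Rd d)) (u : Ctrl d) : Ctrl d where
  τ j ω := if j < v.length then (v.getD j (0, 0)).1
           else max (u.τ (j - v.length) ω) (lastTime v)
  β j ω := if j < v.length then (v.getD j (0, 0)).2 else u.β (j - v.length) ω

/-- Concatenation `u ∘ w` of two impulse controls. -/
def append (T : ℝ) (u w : Ctrl d) : Ctrl d where
  τ j ω := if j < u.Nval T ω then u.τ j ω
           else max (w.τ (j - u.Nval T ω) ω) (u.lastTau T ω)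
  β j ω := if j < u.Nval T ω then u.β j ω else w.β (j - u.Nval T ω) ω

/-- The deterministic control associated with `v ∈ 𝓓` (no further interventions). -/
def ofSeq (T : ℝ) (b₀ : Rd d) (v : List (ℝ × Rd d)) : Ctrl d where
  τ j _ := if j < v.length then (v.getD j (0, 0)).1 else T
  β j _ := (v.getD j (0, b₀)).2

/-- A control taking values in given finite time/space grids. -/
def onGrid (u : Ctrl d) (Tg : Finset ℝ) (Ug : Finset (Rd d)) : Prop :=
  ∀ j ω, u.τ j ω ∈ Tg ∧ u.β j ω ∈ Ug

end Ctrl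

/-- Two probability measures agree on the σ-algebra `F_θ`. -/
def AgreeUpTo {d : ℕ} (θ : PathSpace d → ℝ)
    (P P' : ProbabilityMeasure (PathSpace d)) : Prop :=
  ∀ A : Set (PathSpace d),
    (∀ t : ℝ, MeasurableSet[Filt d t] (A ∩ {ω | θ ω ≤ t})) →
      (P : Measure (PathSpace d)) A = (P' : Measure (PathSpace d)) A

/-- `u_{τ-} = ũ_{τ-}` : the controls agree strictly before the random time `τ`. -/
def AgreeBefore {d : ℕ} (u w : Ctrl d) (τ : PathSpace d → ℝ) : Prop :=
  ∀ ω j, (u.τ j ω < τ ω ∨ w.τ j ω < τ ω) → u.τ j ω = w.τ j ω ∧ u.β j ω = w.β j ω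

/-- The nonlinear expectation `𝓔^u_t[f](ω) := sup_{P ∈ 𝓟(t,ω,u)} E^P[f^{t,ω}]`. -/
def nlE {d : ℕ}
    (P : ℝ → PathSpace d → Ctrl d → Set (ProbabilityMeasure (PathSpace d)))
    (u : Ctrl d) (t : ℝ) (f : PathSpace d → ℝ) (ω : PathSpace d) : ℝ :=
  ⨆ μ ∈ P t ω u, ∫ ω', f (concatAt ω ω' t) ∂(μ : Measure (PathSpace d))

/-- The total cost/reward `φ(v∘u) + ∑_{j=1}^N c(v∘[u]_j)` of an impulse control. -/
def rewardFn {d : ℕ} (T : ℝ) (φ c : PathSpace d → List (ℝ × Rd d) → ℝ)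
    (v : List (ℝ × Rd d)) (u : Ctrl d) (ω : PathSpace d) : ℝ :=
  φ ω (seqConcat v (u.seq (u.Nval T ω) ω))
    + ∑ j ∈ Finset.range (u.Nval T ω), c ω (seqConcat v (u.seq (j + 1) ω))

/-- `𝓔^{v∘u}_t[φ(v∘u) + ∑_j c(v∘[u]_j)](ω)`. -/
def valueJ {d : ℕ} (T : ℝ)
    (P : ℝ → PathSpace d → Ctrl d → Set (ProbabilityMeasure (PathSpace d)))
    (φ c : PathSpace d → List (ℝ × Rd d) → ℝ)
    (v : List (ℝ × Rd d)) (u : Ctrl d) (t : ℝ) (ω : PathSpace d) : ℝ :=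
  nlE P (u.prepend v) t (rewardFn T φ c v u) ω

/-- The upper value function `Y^v_t(ω)`. -/
def upperY {d : ℕ} (T : ℝ) (U : Set (Rd d))
    (P : ℝ → PathSpace d → Ctrl d → Set (ProbabilityMeasure (PathSpace d)))
    (φ c : PathSpace d → List (ℝ × Rd d) → ℝ)
    (v : List (ℝ × Rd d)) (t : ℝ) (ω : PathSpace d) : ℝ :=
  ⨅ u ∈ {u : Ctrl d | u.Valid T U ∧ u.startsAfter t}, valueJ T P φ c v u t ω

/-- The truncated upper value function `Y^{v,k}_t(ω)` (at most `k` impulses). -/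
def upperYk {d : ℕ} (T : ℝ) (U : Set (Rd d))
    (P : ℝ → PathSpace d → Ctrl d → Set (ProbabilityMeasure (PathSpace d)))
    (φ c : PathSpace d → List (ℝ × Rd d) → ℝ) (k : ℕ)
    (v : List (ℝ × Rd d)) (t : ℝ) (ω : PathSpace d) : ℝ :=
  ⨅ u ∈ {u : Ctrl d | u.Valid T U ∧ u.startsAfter t ∧ u.atMost T k},
    valueJ T P φ c v u t ω

/-- A non-anticipative strategy `P^S ∈ 𝓟^S(t,ω)` of the adversary. -/
structure IsStrategy {d : ℕ} (T : ℝ) (U : Set (Rd d))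
    (P : ℝ → PathSpace d → Ctrl d → Set (ProbabilityMeasure (PathSpace d)))
    (t : ℝ) (ω : PathSpace d)
    (S : Ctrl d → ProbabilityMeasure (PathSpace d)) : Prop where
  mem : ∀ u : Ctrl d, S u ∈ P t ω u
  nonanticipative : ∀ (u w : Ctrl d) (τ : StoppingTime d T),
    AgreeBefore u w τ.toFun →
      AgreeUpTo (fun ω' => τ.toFun ω' - t) (S u) (S w)

/-- The lower value function `Z^v_t(ω)`. -/
def lowerZ {d : ℕ} (T : ℝ) (U : Set (Rd d))
    (P : ℝ → PathSpace d → Ctrl d → Set (ProbabilityMeasure (PathSpace d)))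
    (φ c : PathSpace d → List (ℝ × Rd d) → ℝ)
    (v : List (ℝ × Rd d)) (t : ℝ) (ω : PathSpace d) : ℝ :=
  ⨆ S ∈ {S : Ctrl d → ProbabilityMeasure (PathSpace d) | IsStrategy T U P t ω S},
    ⨅ u ∈ {u : Ctrl d | u.Valid T U ∧ u.startsAfter t},
      ∫ ω', rewardFn T φ c v u (concatAt ω ω' t)
        ∂(S (u.prepend v) : Measure (PathSpace d))

/-- The truncated lower value function `Z^{v,k}_t(ω)`. -/
def lowerZk {d : ℕ} (T : ℝ) (U : Set (Rd d))
    (P : ℝ → PathSpace d → Ctrl d → Set (ProbabilityMeasure (PathSpace d)))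
    (φ c : PathSpace d → List (ℝ × Rd d) → ℝ) (k : ℕ)
    (v : List (ℝ × Rd d)) (t : ℝ) (ω : PathSpace d) : ℝ :=
  ⨆ S ∈ {S : Ctrl d → ProbabilityMeasure (PathSpace d) | IsStrategy T U P t ω S},
    ⨅ u ∈ {u : Ctrl d | u.Valid T U ∧ u.startsAfter t ∧ u.atMost T k},
      ∫ ω', rewardFn T φ c v u (concatAt ω ω' t)
        ∂(S (u.prepend v) : Measure (PathSpace d))

/-- The discretized lower value function `Z̄^{v,k,ε}_t(ω)` over grid-valued controls. -/
def barZ {d : ℕ} (T : ℝ) (U : Set (Rd d))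
    (P : ℝ → PathSpace d → Ctrl d → Set (ProbabilityMeasure (PathSpace d)))
    (φ c : PathSpace d → List (ℝ × Rd d) → ℝ)
    (Tg : Finset ℝ) (Ug : Finset (Rd d)) (k : ℕ)
    (v : List (ℝ × Rd d)) (t : ℝ) (ω : PathSpace d) : ℝ :=
  ⨆ S ∈ {S : Ctrl d → ProbabilityMeasure (PathSpace d) | IsStrategy T U P t ω S},
    ⨅ u ∈ {u : Ctrl d | u.Valid T U ∧ u.startsAfter t ∧ u.atMost T k ∧ u.onGrid Tg Ug},
      ∫ ω', rewardFn T φ c v u (concatAt ω ω' t)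
        ∂(S (u.prepend v) : Measure (PathSpace d))

/-- The discretized upper value function `Ȳ^{v,k,ε}_t(ω)` over grid-valued controls. -/
def barY {d : ℕ} (T : ℝ) (U : Set (Rd d))
    (P : ℝ → PathSpace d → Ctrl d → Set (ProbabilityMeasure (PathSpace d)))
    (φ c : PathSpace d → List (ℝ × Rd d) → ℝ)
    (Tg : Finset ℝ) (Ug : Finset (Rd d)) (k : ℕ)
    (v : List (ℝ × Rd d)) (t : ℝ) (ω : PathSpace d) : ℝ :=
  ⨅ u ∈ {u : Ctrl d | u.Valid T U ∧ u.startsAfter t ∧ u.atMost T k ∧ u.onGrid Tg Ug},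
    valueJ T P φ c v u t ω

/-- The obstacle `1_{[r=T]} φ(v) + 1_{[r<T]} inf_{b∈U} {W^{v∘(r,b)}_r + c(v∘(r,b))}` in the DPP. -/
def stopObstacle {d : ℕ} (T : ℝ) (U : Set (Rd d))
    (φ c : PathSpace d → List (ℝ × Rd d) → ℝ)
    (W : List (ℝ × Rd d) → ℝ → PathSpace d → ℝ)
    (v : List (ℝ × Rd d)) (r : ℝ) (ω : PathSpace d) : ℝ :=
  if r = T then φ ω v
  else ⨅ b ∈ U, (W (seqConcat v [(r, b)]) r ω + c ω (seqConcat v [(r, b)]))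

/-- Modulus of continuity. -/
def IsModulus (ρ : ℝ → ℝ) : Prop :=
  Monotone ρ ∧ ρ 0 = 0 ∧ (∀ x, 0 ≤ ρ x) ∧
    Filter.Tendsto ρ (nhdsWithin 0 (Ioi 0)) (nhds 0)

/-- Upper semi-analytic real-valued functions. -/
def UpperSemianalytic {d : ℕ} (f : PathSpace d → ℝ) : Prop :=
  ∀ r : ℝ, MeasureTheory.AnalyticSet {ω : PathSpace d | r < f ω}

/-- Assumptions 1 and 2 of the paper on the family
`{𝓟(t,ω,v∘u)}` of sets of probability measures. -/
structure PFamilyAssumptions (d : ℕ) (T : ℝ) (U : Set (Rd d))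
    (P : ℝ → PathSpace d → Ctrl d → Set (ProbabilityMeasure (PathSpace d))) : Prop where
  /-- Assumption 1: each `𝓟(t,ω,u)` is nonempty. -/
  nonempty : ∀ (t : ℝ) (ω : PathSpace d) (u : Ctrl d),
    u.Valid T U → u.startsAfter t → (P t ω u).Nonempty
  /-- `𝓟(t,ω,u)` depends on `ω` only through `ω|_{[0,t]}`. -/
  localDep : ∀ (t : ℝ) (ω ω' : PathSpace d) (u : Ctrl d),
    (∀ s, s ≤ t → ω.toFun s = ω'.toFun s) → P t ω u = P t ω' u
  /-- Assumption 1: stability under truncation of controls:  `P ∈ 𝓟(u)` if for every `k`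
  there is `P' ∈ 𝓟([u]_k)` with `P' = P` on `F_{τ_k}`. -/
  truncStable : ∀ (ω : PathSpace d) (u : Ctrl d), u.Valid T U →
    ∀ Pm : ProbabilityMeasure (PathSpace d),
      (∀ k : ℕ, ∃ P' ∈ P 0 ω (u.trunc T k), AgreeUpTo (u.τ k) Pm P') →
        Pm ∈ P 0 ω u
  /-- Assumption 2(a): the graph `{(P',ω') : P' ∈ 𝓟(τ,ω',u)}` is analytic. -/
  analyticGraph : ∀ (u : Ctrl d) (τ : StoppingTime d T),
    MeasureTheory.AnalyticSet
      {p : ProbabilityMeasure (PathSpace d) × PathSpace d |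
        p.1 ∈ P (τ.toFun p.2) p.2 u}
  /-- Assumption 2(b): stability under conditioning: regular conditional probabilities
  a.s. belong to the conditioned family and disintegrate `P`. -/
  conditionStable : ∀ (t : ℝ) (ω : PathSpace d) (u : Ctrl d) (τ : StoppingTime d T),
    (∀ ω', t ≤ τ.toFun ω') →
    ∀ Pm ∈ P t ω u,
      ∃ K : PathSpace d → ProbabilityMeasure (PathSpace d),
        (∀ᵐ ω' ∂(Pm : Measure (PathSpace d)),
            K ω' ∈ P (τ.toFun (concatAt ω ω' t)) (concatAt ω ω' t) u) ∧
        (∀ f : PathSpace d → ℝ, Measurable f → (∀ ω'', |f ω''| ≤ 1) →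
          ∫ ω'', f ω'' ∂(Pm : Measure (PathSpace d)) =
            ∫ ω', (∫ ω'', f (concatAt ω' ω'' (τ.toFun (concatAt ω ω' t) - t))
                ∂(K ω' : Measure (PathSpace d))) ∂(Pm : Measure (PathSpace d)))
  /-- Assumption 2(c): stability under pasting along `F_θ`-measurable kernels. -/
  pasteStable : ∀ (t : ℝ) (ω : PathSpace d) (u : Ctrl d) (τ : StoppingTime d T),
    (∀ ω', t ≤ τ.toFun ω') →
    ∀ Pm ∈ P t ω u, ∀ ν : PathSpace d → ProbabilityMeasure (PathSpace d),
      (∀ᵐ ω' ∂(Pm : Measure (PathSpace d)),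
          ν ω' ∈ P (τ.toFun (concatAt ω ω' t)) (concatAt ω ω' t) u) →
      ∃ P' ∈ P t ω u, ∀ f : PathSpace d → ℝ, Measurable f → (∀ ω'', |f ω''| ≤ 1) →
        ∫ ω'', f ω'' ∂(P' : Measure (PathSpace d)) =
          ∫ ω', (∫ ω'', f (concatAt ω' ω'' (τ.toFun (concatAt ω ω' t) - t))
              ∂(ν ω' : Measure (PathSpace d))) ∂(Pm : Measure (PathSpace d))
  /-- Assumption 2(d): consistency for controls agreeing strictly before a stopping time. -/
  consistency : ∀ (t : ℝ) (ω : PathSpace d) (u w : Ctrl d) (τ : StoppingTime d T),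
    u.Valid T U → w.Valid T U → AgreeBefore u w τ.toFun →
    ∀ Pm ∈ P t ω u, ∃ P' ∈ P t ω w,
      AgreeUpTo (fun ω' => τ.toFun ω' - t) Pm P'

/-- Assumption 3 of the paper on the terminal reward `φ` and the intervention cost `c`. -/
structure CostAssumptions (d : ℕ) (T : ℝ) (U : Set (Rd d)) (δ C₀ : ℝ)
    (φ c : PathSpace d → List (ℝ × Rd d) → ℝ) : Prop where
  δ_pos : 0 < δ
  bdd : ∀ (ω : PathSpace d) (v : List (ℝ × Rd d)), InD T U v →
    |φ ω v| + |c ω v| ≤ C₀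
  c_lower : ∀ (ω : PathSpace d) (v : List (ℝ × Rd d)), InD T U v → δ ≤ c ω v
  φ_cont : ∀ κ : ℕ, ∃ ρ : ℝ → ℝ, IsModulus ρ ∧
    ∀ (ω ω' : PathSpace d) (v v' : List (ℝ × Rd d)),
      InD T U v → InD T U v' → v.length = κ → v'.length = κ →
      (∀ j, j < κ → entryT v j ≤ entryT v' j) →
      |φ ω' v' - φ ω v| ≤ ρ (dK T (T, ω, v) (T, ω', v'))
  c_cont : ∀ κ : ℕ, ∃ ρ : ℝ → ℝ, IsModulus ρ ∧
    ∀ (ω ω' : PathSpace d) (v v' : List (ℝ × Rd d)),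
      InD T U v → InD T U v' → v.length = κ → v'.length = κ →
      |c ω' v' - c ω v| ≤ ρ (dK T (lastTime v, ω, v) (lastTime v', ω', v'))
  c_meas : ∀ u : Ctrl d, u.Valid T U → ∀ j : ℕ,
    Measurable[FiltStop d (u.τ j)] fun ω => c ω (u.seq (j + 1) ω)
  no_imp_at_T : ∀ (ω : PathSpace d) (v : List (ℝ × Rd d)) (b : Rd d),
    InD T U v → b ∈ U →
      φ ω v < φ ω (seqConcat v [(T, b)]) + c ω (seqConcat v [(T, b)])

/-- Assumption 4 of the paper, with an explicitly given family of moduli `ρ_{𝓔,i}`. -/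
def Assumption4With {d : ℕ} (T : ℝ) (U : Set (Rd d))
    (P : ℝ → PathSpace d → Ctrl d → Set (ProbabilityMeasure (PathSpace d)))
    (φ c : PathSpace d → List (ℝ × Rd d) → ℝ) (ρ : ℕ → ℝ → ℝ) : Prop :=
  ∀ (κ k : ℕ) (v v' : List (ℝ × Rd d)) (t : ℝ) (ω' : PathSpace d) (u : Ctrl d),
    InD T U v → InD T U v' → v.length = κ → v'.length = κ →
    u.Valid T U → u.startsAfter t → u.atMost T k →
    ∃ w : PathSpace d → Ctrl d,
      (∀ ω, (w ω).Valid T U ∧ (w ω).startsAfter t ∧ (w ω).atMost T k) ∧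
      (∀ j, Measurable[(Filt d t).prod inferInstance]
        fun p : PathSpace d × PathSpace d => ((w p.1).τ j p.2, (w p.1).β j p.2)) ∧
      ∀ ω, valueJ T P φ c v' u t ω' - valueJ T P φ c v (w ω) t ω
            ≤ ρ (κ + k) (dK T (t, ω, v) (t, ω', v'))

/-- Assumption 4 of the paper. -/
def Assumption4 {d : ℕ} (T : ℝ) (U : Set (Rd d))
    (P : ℝ → PathSpace d → Ctrl d → Set (ProbabilityMeasure (PathSpace d)))
    (φ c : PathSpace d → List (ℝ × Rd d) → ℝ) : Prop :=
  ∃ ρ : ℕ → ℝ → ℝ, (∀ i, IsModulus (ρ i)) ∧ Assumption4With T U P φ c ρ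

/-- Assumption 5 of the paper: uniform modulus bound for the canonical process. -/
def Assumption5 {d : ℕ} (T : ℝ)
    (P : ℝ → PathSpace d → Ctrl d → Set (ProbabilityMeasure (PathSpace d))) : Prop :=
  ∀ ρ : ℝ → ℝ, IsModulus ρ → ∃ ρ' : ℝ → ℝ, IsModulus ρ' ∧
    ∀ (τ : StoppingTime d T) (ε t : ℝ) (ω : PathSpace d) (u : Ctrl d), 0 < ε →
      ∀ μ ∈ P t ω u,
        ∫ ω', ρ (ε + supOn (Icc (τ.toFun ω') (τ.toFun ω' + ε)) fun s => ‖ω'.toFun s‖)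
          ∂(μ : Measure (PathSpace d)) ≤ ρ' ε

/-- Admissible `(𝕋^ε, Ū^ε)` discretization grids of mesh `ε`. -/
structure IsGridPair {d : ℕ} (T ε : ℝ) (U : Set (Rd d))
    (Tg : Finset ℝ) (Ug : Finset (Rd d)) : Prop where
  subset_Icc : ∀ s ∈ Tg, s ∈ Icc (0 : ℝ) T
  T_mem : T ∈ Tg
  mesh : ∀ s ∈ Icc (0 : ℝ) T, ∃ s' ∈ Tg, s ≤ s' ∧ s' - s ≤ ε
  U_subset : ∀ b ∈ Ug, b ∈ U
  U_net : ∀ b ∈ U, ∃ b' ∈ Ug, ‖b - b'‖ ≤ ε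

end

/- Additional framework for Section 6: path-dependent stochastic differential
games of impulse versus classical control. -/

noncomputable section

/-- Auxiliary impulse operator, taking the impulse sequence in reverse order. -/
def impulseOpAux {d : ℕ} (Γ : ℝ → (ℝ → Rd d) → Rd d → Rd d) (ω : PathSpace d) :
    List (ℝ × Rd d) → ℝ → Rd d
  | [] => fun s => ω.toFun s
  | p :: rest => fun s =>
      impulseOpAux Γ ω rest s +
        if p.1 ≤ s then Γ p.1 (impulseOpAux Γ ω rest) p.2 else 0

/-- The impulse operator `𝓘^v`, adding the jumps `Γ(t_i, 𝓘^{v_{<i}}(ω), b_i)` at the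
times `t_i` to the continuous trajectory `ω`. -/
def impulseOp {d : ℕ} (Γ : ℝ → (ℝ → Rd d) → Rd d → Rd d)
    (v : List (ℝ × Rd d)) (ω : PathSpace d) : ℝ → Rd d :=
  impulseOpAux Γ ω v.reverse

/-- `𝓘^u` for an impulse control `u`, evaluated along the realized interventions. -/
def impulseCtrl {d : ℕ} (Γ : ℝ → (ℝ → Rd d) → Rd d → Rd d) (T : ℝ)
    (u : Ctrl d) (ω : PathSpace d) : ℝ → Rd d :=
  impulseOp Γ (u.seq (u.Nval T ω) ω) ω

/-- The exceptional set `Υ^{v,v'} := ∪_j [t_j ∧ t'_j, t_j ∨ t'_j)`. -/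
def Upsilon {d : ℕ} (v v' : List (ℝ × Rd d)) : Set ℝ :=
  ⋃ j ∈ Finset.range (max v.length v'.length),
    Set.Ico (min (entryT v j) (entryT v' j)) (max (entryT v j) (entryT v' j))

/-- The path `0 ⊗_t B` : zero up to time `t`, then the increments of `ω'`. -/
def shiftPath {d : ℕ} (t : ℝ) (ω' : PathSpace d) : PathSpace d :=
  concatAt (PathSpace.zero d) ω' t

/-- An abstract Itô framework: the Wiener measure `P₀` (characterized by Gaussian
increments independent of the past) together with a stochastic-integral operator
`SI` vanishing at time `0` and satisfying an `L²` (Itô isometry /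
Burkholder-Davis-Gundy type) estimate for adapted integrands.  Matrices are
encoded as elements of `Fin d → Rd d`. -/
structure ItoFramework (d : ℕ) (T : ℝ) where
  P₀ : MeasureTheory.Measure (PathSpace d)
  P₀_prob : MeasureTheory.IsProbabilityMeasure P₀
  gauss : ∀ s t : ℝ, 0 ≤ s → s ≤ t → ∀ i : Fin d,
    P₀.map (fun ω : PathSpace d => ω.toFun t i - ω.toFun s i)
      = ProbabilityTheory.gaussianReal 0 (Real.toNNReal (t - s))
  indep : ∀ s t : ℝ, 0 ≤ s → s ≤ t →
    ProbabilityTheory.IndepFun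
      (fun ω : PathSpace d => ω.toFun t - ω.toFun s)
      (fun (ω : PathSpace d) (r : ℝ) => ω.toFun (min r s)) P₀
  SI : (ℝ → PathSpace d → (Fin d → Rd d)) → ℝ → PathSpace d → Rd d
  SI_init : ∀ h s ω, s ≤ 0 → SI h s ω = 0
  SI_bdg : ∃ C : ℝ, 0 < C ∧
    ∀ h h' : ℝ → PathSpace d → (Fin d → Rd d),
      (∀ r : ℝ, Measurable[Filt d r] (h r)) →
      (∀ r : ℝ, Measurable[Filt d r] (h' r)) →
      ∀ s : ℝ, 0 ≤ s →
        ∫ ω, (supOn (Set.Icc 0 s) fun r => ‖SI h r ω - SI h' r ω‖) ^ 2 ∂P₀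
          ≤ C * ∫ ω, (∫ r in Set.Icc (0 : ℝ) s, ‖h r ω - h' r ω‖ ^ 2) ∂P₀

/-- Assumption 6 of the paper on the controlled coefficients `σ` and `Γ`
(the Lipschitz condition on `Γ` is stated along the decomposition of the
controlled path into its continuous part and its jumps). -/
structure SDEAssumptions (d : ℕ) (T : ℝ) (U A : Set (Rd d))
    (σ : ℝ → (ℝ → Rd d) → Rd d → (Fin d → Rd d))
    (Γ : ℝ → (ℝ → Rd d) → Rd d → Rd d) : Prop where
  A_bdd : Bornology.IsBounded A
  σ_bdd : ∃ C : ℝ, 0 < C ∧ ∀ t x a, ‖σ t x a‖ ≤ C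
  σ_lip : ∃ C : ℝ, 0 < C ∧ ∀ (t : ℝ) (x x' : ℝ → Rd d) (a : Rd d),
    ‖σ t x' a - σ t x a‖ ≤ C * supOn (Set.Icc 0 t) fun s => ‖x' s - x s‖
  σ_L2 : ∃ C : ℝ, 0 < C ∧ ∀ (t : ℝ) (x x' : ℝ → Rd d) (α : ℝ → Rd d), 0 ≤ t →
    (∫ s in Set.Icc (0 : ℝ) t, ‖σ s x' (α s) - σ s x (α s)‖ ^ 2)
      ≤ C * ∫ s in Set.Icc (0 : ℝ) t, ‖x' s - x s‖ ^ 2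
  σ_inv : ∃ σinv : ℝ → (ℝ → Rd d) → (Fin d → Rd d) → Rd d,
    ∀ t x a, a ∈ A → σinv t x (σ t x a) = a
  Γ_lip : ∃ C : ℝ, 0 < C ∧
    ∀ (t t' : ℝ) (ω ω' : PathSpace d) (v v' : List (ℝ × Rd d)) (b b' : Rd d),
      v.length = v'.length →
        ‖Γ t' (impulseOp Γ v' ω') b' - Γ t (impulseOp Γ v ω) b‖
          ≤ C * (dK T (t, ω, v) (t', ω', v') + ‖b' - b‖)

/-- Admissible classical controls `α ∈ 𝓐_t`: adapted, right-continuous, `A`-valued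
and independent of the trajectory before time `t`. -/
def IsAdmissibleCtrl {d : ℕ} (A : Set (Rd d)) (t : ℝ)
    (α : ℝ → PathSpace d → Rd d) : Prop :=
  (∀ r ω, α r ω ∈ A) ∧
  (∀ r : ℝ, Measurable[Filt d r] (α r)) ∧
  (∀ (ω : PathSpace d) (r : ℝ), ContinuousWithinAt (fun r' => α r' ω) (Set.Ici r) r) ∧
  (∀ (r : ℝ) (ω ω' : PathSpace d),
    (∀ s, t ≤ s → ω.toFun s - ω.toFun t = ω'.toFun s - ω'.toFun t) → α r ω = α r ω')

/-- `X` is the (family of truncated) solution(s) of the impulsively and continuously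
controlled path-dependent SDE (6.3): `X^j` equals `ω` before `t`, evolves as the
stochastic integral of `σ(s, X^j, α_s)`, and receives the jumps
`Γ(τ_i(0⊗_t B), X^{i}, β_i(0⊗_t B))` at the intervention times of `u`. -/
def SolvesHat {d : ℕ} {T : ℝ} (fw : ItoFramework d T)
    (σ : ℝ → (ℝ → Rd d) → Rd d → (Fin d → Rd d))
    (Γ : ℝ → (ℝ → Rd d) → Rd d → Rd d)
    (t : ℝ) (ω : PathSpace d) (u : Ctrl d) (α : ℝ → PathSpace d → Rd d)
    (X : ℕ → PathSpace d → ℝ → Rd d) : Prop :=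
  ∀ (j : ℕ) (ω' : PathSpace d) (s : ℝ),
    X j ω' s =
      (if s ≤ t then ω.toFun s
        else ω.toFun t
          + fw.SI (fun r ω'' => σ (t + r) (X j ω'') (α (t + r) ω'')) (s - t) ω')
      + ∑ i ∈ Finset.range j,
          (if u.τ i (shiftPath t ω') < T ∧ u.τ i (shiftPath t ω') ≤ s
            then Γ (u.τ i (shiftPath t ω')) (X i ω') (u.β i (shiftPath t ω'))
            else 0)

/-- `X̄` solves the path-dependent SDE (6.6) implementing the impulses in feedback
form: `X̄_s = ∫_0^s σ(t+r, 𝓘^u(ω ⊗_t X̄), α_{t+r}) dB_r` (as increments from `ω_t`). -/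
def SolvesBar {d : ℕ} {T : ℝ} (fw : ItoFramework d T)
    (σ : ℝ → (ℝ → Rd d) → Rd d → (Fin d → Rd d))
    (Γ : ℝ → (ℝ → Rd d) → Rd d → Rd d)
    (t : ℝ) (ω : PathSpace d) (u : Ctrl d) (α : ℝ → PathSpace d → Rd d)
    (Xb : PathSpace d → PathSpace d) : Prop :=
  ∀ (ω' : PathSpace d) (s : ℝ),
    (Xb ω').toFun s =
      fw.SI (fun r ω'' =>
        σ (t + r) (impulseCtrl Γ T u (concatAt ω (Xb ω'') t)) (α (t + r) ω'')) s ω'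

/-- The family `𝓟(t,ω,u) := {P₀ ∘ (X̄^{u,α,t,ω})⁻¹ : α ∈ 𝓐}` of laws of the
controlled state process. -/
def PSDE {d : ℕ} {T : ℝ} (fw : ItoFramework d T)
    (σ : ℝ → (ℝ → Rd d) → Rd d → (Fin d → Rd d))
    (Γ : ℝ → (ℝ → Rd d) → Rd d → Rd d) (A : Set (Rd d))
    (t : ℝ) (ω : PathSpace d) (u : Ctrl d) :
    Set (ProbabilityMeasure (PathSpace d)) :=
  {P | ∃ (α : ℝ → PathSpace d → Rd d) (Xb : PathSpace d → PathSpace d),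
    IsAdmissibleCtrl A t α ∧ SolvesBar fw σ Γ t ω u α Xb ∧ Measurable Xb ∧
    (P : MeasureTheory.Measure (PathSpace d)) = fw.P₀.map Xb}

/-- The terminal reward `φ(ω,v) := ∫_0^T φ̃(t, (𝓘^v(ω))_t) dt + ψ((𝓘^v(ω))_T)`. -/
def phiSDE {d : ℕ} (T : ℝ) (Γ : ℝ → (ℝ → Rd d) → Rd d → Rd d)
    (φt : ℝ → Rd d → ℝ) (ψ : Rd d → ℝ)
    (ω : PathSpace d) (v : List (ℝ × Rd d)) : ℝ :=
  (∫ t in Set.Icc (0 : ℝ) T, φt t (impulseOp Γ v ω t)) + ψ (impulseOp Γ v ω T)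

/-- The intervention cost `c(ω,(t_i,b_i)_{i=1}^j) := ℓ(t_j, (𝓘^{(t_i,b_i)_{i<j}}(ω))_{t_j}, b_j)`. -/
def cSDE {d : ℕ} (Γ : ℝ → (ℝ → Rd d) → Rd d → Rd d)
    (ℓ : ℝ → Rd d → Rd d → ℝ)
    (ω : PathSpace d) (v : List (ℝ × Rd d)) : ℝ :=
  ℓ (lastTime v) (impulseOp Γ v.dropLast ω (lastTime v)) (entryB v (v.length - 1))

/-- Assumption 6 of the paper on the rewards `φ̃`, `ψ` and the intervention cost `ℓ`. -/
structure RewardAssumptions (d : ℕ) (T δ : ℝ) (U : Set (Rd d))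
    (φt : ℝ → Rd d → ℝ) (ψ : Rd d → ℝ) (ℓ : ℝ → Rd d → Rd d → ℝ) : Prop where
  δ_pos : 0 < δ
  φt_bdd : ∃ C : ℝ, ∀ t x, |φt t x| ≤ C
  φt_meas : Measurable fun p : ℝ × Rd d => φt p.1 p.2
  φt_cont : ∃ ρ : ℝ → ℝ, IsModulus ρ ∧ ∀ t x x', |φt t x' - φt t x| ≤ ρ ‖x' - x‖
  ψ_bdd : ∃ C : ℝ, ∀ x, |ψ x| ≤ C
  ψ_cont : ∃ ρ : ℝ → ℝ, IsModulus ρ ∧ ∀ x x', |ψ x' - ψ x| ≤ ρ ‖x' - x‖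
  ℓ_bdd : ∃ C : ℝ, ∀ t x b, |ℓ t x b| ≤ C
  ℓ_lower : ∀ t x b, δ ≤ ℓ t x b
  ℓ_cont : ∃ ρ : ℝ → ℝ, IsModulus ρ ∧ ∀ t t' x x' b b',
    |ℓ t' x' b' - ℓ t x b| ≤ ρ (|t' - t| + ‖x' - x‖ + ‖b' - b‖)

end

section UniformPaths

variable {α K E : Type*} [MetricSpace K] [CompactSpace K] [Nonempty K]
  [NormedAddCommGroup E] [SecondCountableTopology E] [MeasurableSpace E] [BorelSpace E]

/-- A map into `C(K, E)` whose evaluations are measurable pulls uniformly open sets back to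
measurable sets. -/
lemma measurableSet_preimage_of_measurable_eval {m : MeasurableSpace α} {Φ : α → C(K, E)}
    (hΦ : ∀ x, Measurable fun a => Φ a x) {O : Set C(K, E)} (hO : IsOpen O) :
    MeasurableSet (Φ ⁻¹' O) := by
  have hdist (g : C(K, E)) : Measurable fun a => dist (Φ a) g := by
    refine measurable_of_Iic fun r => ?_
    have hset : (fun a => dist (Φ a) g) ⁻¹' Iic r
        = ⋂ n, {a | dist (Φ a (TopologicalSpace.denseSeq K n))
            (g (TopologicalSpace.denseSeq K n)) ≤ r} := by
      ext a
      simp only [mem_preimage, mem_Iic, mem_iInter, mem_ofPred_eq,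
        ContinuousMap.dist_le_iff_of_nonempty]
      refine ⟨fun h n => h _, fun h x => ?_⟩
      refine (TopologicalSpace.denseRange_denseSeq K).induction_on
        (p := fun x => dist (Φ a x) (g x) ≤ r) x ?_ h
      exact isClosed_le (by fun_prop) continuous_const
    rw [hset]
    exact MeasurableSet.iInter fun n =>
      measurableSet_le ((hΦ _).dist measurable_const) measurable_const
  choose! r hr hball using fun g (hg : g ∈ O) => Metric.isOpen_iff.1 hO g hg
  obtain ⟨S, hS, hSO⟩ := TopologicalSpace.isOpen_iUnion_countable
    (fun g : O => Metric.ball (g : C(K, E)) (r g)) fun _ => Metric.isOpen_ball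
  have hO_eq : O = ⋃ g ∈ S, Metric.ball (g : C(K, E)) (r g) := by
    rw [hSO]
    refine Subset.antisymm (fun g hg => mem_iUnion.2 ⟨⟨g, hg⟩, ?_⟩)
      (iUnion_subset fun g => hball g g.2)
    exact Metric.mem_ball_self (hr g hg)
  rw [hO_eq, preimage_iUnion₂]
  exact MeasurableSet.biUnion hS fun g _ => measurableSet_lt (hdist g) measurable_const

/-- A function controlled, with some modulus, by the uniform distance of paths is measurable for
the cylinder `σ`-algebra of these paths. -/
lemma measurable_of_abs_sub_le_modulus {m : MeasurableSpace α} {Φ : α → C(K, E)}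
    (hΦ : ∀ x, Measurable fun a => Φ a x) {ρ : ℝ → ℝ} (hρ : IsModulus ρ) {f : α → ℝ}
    (hf : ∀ a b, |f b - f a| ≤ ρ (dist (Φ b) (Φ a))) : Measurable f := by
  refine measurable_of_isOpen fun V hV => ?_
  choose! ε hε hball using fun y (hy : y ∈ V) => Metric.isOpen_iff.1 hV y hy
  have hsmall (a : α) (ha : f a ∈ V) : ∃ η > 0, ρ η < ε (f a) := by
    obtain ⟨η, hη, hpos⟩ := ((hρ.2.2.2.eventually (gt_mem_nhds (hε _ ha))).and
      self_mem_nhdsWithin).exists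
    exact ⟨η, hpos, hη⟩
  choose! η hη hρη using hsmall
  have hset : f ⁻¹' V = Φ ⁻¹' ⋃ a ∈ f ⁻¹' V, Metric.ball (Φ a) (η a) := by
    ext b
    simp only [mem_preimage, mem_iUnion, Metric.mem_ball, exists_prop]
    refine ⟨fun hb => ⟨b, hb, by simpa using hη b hb⟩, ?_⟩
    rintro ⟨a, ha, hab⟩
    refine hball _ ha ?_
    rw [Metric.mem_ball, Real.dist_eq]
    exact (hf a b).trans_lt ((hρ.1 hab.le).trans_lt (hρη a ha))
  rw [hset]
  exact measurableSet_preimage_of_measurable_eval hΦ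
    (isOpen_biUnion fun _ _ => Metric.isOpen_ball)

end UniformPaths

namespace IsModulus

variable {ρ ρ' : ℝ → ℝ}

lemma add (h : IsModulus ρ) (h' : IsModulus ρ') : IsModulus fun x => ρ x + ρ' x := by
  refine ⟨h.1.add h'.1, by simp [h.2.1, h'.2.1], fun x => add_nonneg (h.2.2.1 x) (h'.2.2.1 x), ?_⟩
  simpa using h.2.2.2.add h'.2.2.2

lemma comp (h : IsModulus ρ) (h' : IsModulus ρ') : IsModulus fun x => ρ (ρ' x) := by
  refine ⟨h.1.comp h'.1, by simp [h.2.1, h'.2.1], fun x => h.2.2.1 _, ?_⟩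
  have hmem : Ici (0 : ℝ) = insert 0 (Ioi 0) := by simp [Ioi_insert]
  have h0 : Filter.Tendsto ρ (nhdsWithin 0 (Ici 0)) (nhds 0) := by
    rw [hmem, nhdsWithin_insert, Filter.tendsto_sup]
    refine ⟨?_, h.2.2.2⟩
    have := tendsto_pure_nhds ρ (0 : ℝ)
    rwa [h.2.1] at this
  exact h0.comp (tendsto_nhdsWithin_iff.2
    ⟨h'.2.2.2, Filter.Eventually.of_forall fun x => h'.2.2.1 x⟩)

lemma const_mul (h : IsModulus ρ) {C : ℝ} (hC : 0 ≤ C) : IsModulus fun x => C * ρ x := by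
  refine ⟨h.1.const_mul hC, by simp [h.2.1], fun x => mul_nonneg hC (h.2.2.1 x), ?_⟩
  simpa using h.2.2.2.const_mul C

lemma max_zero : IsModulus fun x => max x 0 := by
  refine ⟨fun x y h => max_le_max_right 0 h, by simp, fun x => le_max_right _ _, ?_⟩
  have : Filter.Tendsto (fun x : ℝ => max x 0) (nhds 0) (nhds (max 0 0)) :=
    (continuous_id.max continuous_const).tendsto 0
  rw [max_self] at this
  exact this.mono_left nhdsWithin_le_nhds

end IsModulus

section SupOn

variable {S : Set ℝ} {f : ℝ → ℝ}

lemma le_supOn (hf : BddAbove (f '' S)) {s : ℝ} (hs : s ∈ S) : f s ≤ supOn S f :=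
  le_csSup hf (mem_image_of_mem f hs)

lemma supOn_nonneg (hf : ∀ s, 0 ≤ f s) : 0 ≤ supOn S f :=
  Real.sSup_nonneg (by rintro _ ⟨s, _, rfl⟩; exact hf s)

lemma supOn_le (hS : S.Nonempty) {B : ℝ} (hf : ∀ s ∈ S, f s ≤ B) : supOn S f ≤ B :=
  csSup_le (hS.image f) (by rintro _ ⟨s, hs, rfl⟩; exact hf s hs)

end SupOn

section ImpulseSequences

variable {d : ℕ} {T : ℝ} {U : Set (Rd d)} {v v' : List (ℝ × Rd d)}

lemma getD_eq_entry (v : List (ℝ × Rd d)) (j : ℕ) :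
    v.getD j (0, 0) = (entryT v j, entryB v j) := rfl

lemma getElem_eq_entry {j : ℕ} (hj : j < v.length) : v[j] = (entryT v j, entryB v j) := by
  rw [← getD_eq_entry, List.getD_eq_getElem _ _ hj]

lemma entryT_take {i j : ℕ} (hj : j < i) : entryT (v.take i) j = entryT v j := by
  simp [entryT, List.getD_eq_getElem?_getD, hj]

lemma entryB_take {i j : ℕ} (hj : j < i) : entryB (v.take i) j = entryB v j := by
  simp [entryB, List.getD_eq_getElem?_getD, hj]

lemma lastTime_le_iff {B : ℝ} : lastTime v ≤ B ↔ 0 ≤ B ∧ ∀ p ∈ v, p.1 ≤ B := by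
  induction v with
  | nil => simp [lastTime]
  | cons p v ih =>
    have : lastTime (p :: v) = max p.1 (lastTime v) := rfl
    rw [this, max_le_iff, ih]
    simp only [List.mem_cons, forall_eq_or_imp]
    tauto

lemma lastTime_nonneg (v : List (ℝ × Rd d)) : 0 ≤ lastTime v := (lastTime_le_iff.1 le_rfl).1

lemma entryT_le_lastTime {j : ℕ} (hj : j < v.length) : entryT v j ≤ lastTime v := by
  have := (lastTime_le_iff.1 (le_refl (lastTime v))).2 _ (List.getElem_mem hj)
  rwa [getElem_eq_entry hj] at this

namespace InD

lemma entryT_mem (hv : InD T U v) {j : ℕ} (hj : j < v.length) : entryT v j ∈ Icc 0 T := by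
  have := (hv.2 _ (List.getElem_mem hj)).1
  rwa [getElem_eq_entry hj] at this

lemma entryT_mono (hv : InD T U v) {i j : ℕ} (hij : i ≤ j) (hj : j < v.length) :
    entryT v i ≤ entryT v j := by
  rcases hij.eq_or_lt with rfl | hij
  · rfl
  have htrans : IsTrans (ℝ × Rd d) fun p q => p.1 ≤ q.1 := ⟨fun _ _ _ => le_trans⟩
  have := List.pairwise_iff_getElem.1 (List.isChain_iff_pairwise.1 hv.1) i j (hij.trans hj) hj hij
  rwa [getElem_eq_entry hj, getElem_eq_entry (hij.trans hj)] at this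

lemma lastTime_le (hT : 0 ≤ T) (hv : InD T U v) : lastTime v ≤ T :=
  lastTime_le_iff.2 ⟨hT, fun p hp => (hv.2 p hp).1.2⟩

lemma lastTime_eq (hv : InD T U v) (hpos : 0 < v.length) :
    lastTime v = entryT v (v.length - 1) := by
  have hlast : v.length - 1 < v.length := by omega
  refine le_antisymm (lastTime_le_iff.2 ⟨(hv.entryT_mem hlast).1, fun p hp => ?_⟩)
    (entryT_le_lastTime hlast)
  obtain ⟨j, hj, rfl⟩ := List.getElem_of_mem hp
  rw [getElem_eq_entry hj]
  exact hv.entryT_mono (by omega) hlast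

end InD

lemma seqDist_nonneg (v v' : List (ℝ × Rd d)) : 0 ≤ seqDist v v' :=
  Finset.sum_nonneg fun _ _ => by positivity

lemma entry_dist_le_seqDist {j : ℕ} (hj : j < v.length) :
    |entryT v' j - entryT v j| + ‖entryB v' j - entryB v j‖ ≤ seqDist v v' :=
  Finset.single_le_sum (f := fun j => |entryT v' j - entryT v j| + ‖entryB v' j - entryB v j‖)
    (fun _ _ => by positivity) (Finset.mem_range.2 (hj.trans_le (le_max_left _ _)))

end ImpulseSequences

section StoppedDistance

variable {d : ℕ} {T : ℝ}

/-- Uniform distance on `[0,T]` between `ω` stopped at `t` and `ω'` stopped at `t'`. -/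
noncomputable def stoppedDist (T t t' : ℝ) (ω ω' : PathSpace d) : ℝ :=
  supOn (Icc 0 T) fun s => ‖ω'.toFun (min s t') - ω.toFun (min s t)‖

lemma stoppedDist_nonneg (t t' : ℝ) (ω ω' : PathSpace d) : 0 ≤ stoppedDist T t t' ω ω' :=
  supOn_nonneg fun _ => norm_nonneg _

lemma norm_sub_le_stoppedDist (hT : 0 ≤ T) {t t' : ℝ} (ht : t ≤ T) (ht' : t' ≤ T)
    (ω ω' : PathSpace d) : ‖ω'.toFun t' - ω.toFun t‖ ≤ stoppedDist T t t' ω ω' := by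
  have hω := ω.continuous_toFun
  have hω' := ω'.continuous_toFun
  have hcont : Continuous fun s => ‖ω'.toFun (min s t') - ω.toFun (min s t)‖ := by fun_prop
  have := le_supOn (isCompact_Icc.bddAbove_image hcont.continuousOn) (right_mem_Icc.2 hT)
  simpa only [stoppedDist, min_eq_right ht, min_eq_right ht'] using this

lemma dK_eq (t t' : ℝ) (ω ω' : PathSpace d) (v v' : List (ℝ × Rd d)) :
    dK T (t, ω, v) (t', ω', v') = stoppedDist T t t' ω ω'
      + ∑ j ∈ Finset.range v.length,
          stoppedDist T (min (entryT v j) t) (min (entryT v' j) t') ω ω'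
      + seqDist v v' := rfl

lemma stoppedDist_le_dK (t t' : ℝ) (ω ω' : PathSpace d) (v v' : List (ℝ × Rd d)) :
    stoppedDist T t t' ω ω' ≤ dK T (t, ω, v) (t', ω', v') := by
  rw [dK_eq]
  have := Finset.sum_nonneg fun j (_ : j ∈ Finset.range v.length) =>
    stoppedDist_nonneg (T := T) (min (entryT v j) t) (min (entryT v' j) t') ω ω'
  linarith [seqDist_nonneg v v']

lemma seqDist_le_dK (t t' : ℝ) (ω ω' : PathSpace d) (v v' : List (ℝ × Rd d)) :
    seqDist v v' ≤ dK T (t, ω, v) (t', ω', v') := by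
  rw [dK_eq]
  have := Finset.sum_nonneg fun j (_ : j ∈ Finset.range v.length) =>
    stoppedDist_nonneg (T := T) (min (entryT v j) t) (min (entryT v' j) t') ω ω'
  linarith [stoppedDist_nonneg (T := T) t t' ω ω']

lemma dK_nonneg (t t' : ℝ) (ω ω' : PathSpace d) (v v' : List (ℝ × Rd d)) :
    0 ≤ dK T (t, ω, v) (t', ω', v') :=
  (seqDist_nonneg v v').trans (seqDist_le_dK _ _ _ _ _ _)

/-- Truncating two impulse sequences before their `i`-th entries, and stopping the paths at these
entries, does not increase the pseudo-distance. -/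
lemma dK_take_le {U : Set (Rd d)} {v v' : List (ℝ × Rd d)} (hv : InD T U v) (hv' : InD T U v')
    (hlen : v.length = v'.length) {i : ℕ} (hi : i < v.length) (ω ω' : PathSpace d) :
    dK T (entryT v i, ω, v.take i) (entryT v' i, ω', v'.take i)
      ≤ dK T (lastTime v, ω, v) (lastTime v', ω', v') := by
  have hi' : i < v'.length := hlen ▸ hi
  have hl : (v.take i).length = i := by simp [hi.le]
  have hl' : (v'.take i).length = i := by simp [hi'.le]
  set S : ℕ → ℝ := fun j => stoppedDist T (entryT v j) (entryT v' j) ω ω' with hS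
  have hsmall : ∑ j ∈ Finset.range (v.take i).length,
      stoppedDist T (min (entryT (v.take i) j) (entryT v i))
        (min (entryT (v'.take i) j) (entryT v' i)) ω ω' = ∑ j ∈ Finset.range i, S j := by
    rw [hl]
    refine Finset.sum_congr rfl fun j hj => ?_
    have hj := Finset.mem_range.1 hj
    rw [entryT_take hj, entryT_take hj, min_eq_left (hv.entryT_mono hj.le hi),
      min_eq_left (hv'.entryT_mono hj.le hi')]
  have hbig : ∑ j ∈ Finset.range v.length,
      stoppedDist T (min (entryT v j) (lastTime v)) (min (entryT v' j) (lastTime v')) ω ω'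
        = ∑ j ∈ Finset.range v.length, S j := by
    refine Finset.sum_congr rfl fun j hj => ?_
    have hj := Finset.mem_range.1 hj
    rw [min_eq_left (entryT_le_lastTime hj), min_eq_left (entryT_le_lastTime (hlen ▸ hj))]
  have hsum : ∑ j ∈ Finset.range i, S j + S i ≤ ∑ j ∈ Finset.range v.length, S j := by
    rw [← Finset.sum_range_succ]
    exact Finset.sum_le_sum_of_subset_of_nonneg (Finset.range_subset_range.2 hi)
      fun _ _ _ => stoppedDist_nonneg _ _ _ _
  have hseq : seqDist (v.take i) (v'.take i) ≤ seqDist v v' := by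
    unfold seqDist
    rw [hl, hl', max_self, ← hlen, max_self]
    refine le_trans (le_of_eq (Finset.sum_congr rfl fun j hj => ?_))
      (Finset.sum_le_sum_of_subset_of_nonneg (Finset.range_subset_range.2 hi.le)
        fun _ _ _ => by positivity)
    have hj := Finset.mem_range.1 hj
    rw [entryT_take hj, entryT_take hj, entryB_take hj, entryB_take hj]
  rw [dK_eq, dK_eq, hsmall, hbig]
  have := stoppedDist_nonneg (T := T) (lastTime v) (lastTime v') ω ω'
  change S i + _ + _ ≤ _
  linarith

end StoppedDistance

section ImpulseOperator

variable {d : ℕ} {T : ℝ} {U : Set (Rd d)} (Γ : ℝ → (ℝ → Rd d) → Rd d → Rd d)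

/-- The jump that the `i`-th entry of `v` adds to the controlled path. -/
noncomputable def jumpAt (v : List (ℝ × Rd d)) (ω : PathSpace d) (i : ℕ) : Rd d :=
  Γ (entryT v i) (impulseOp Γ (v.take i) ω) (entryB v i)

lemma impulseOp_append_singleton (v : List (ℝ × Rd d)) (p : ℝ × Rd d) (ω : PathSpace d) (s : ℝ) :
    impulseOp Γ (v ++ [p]) ω s
      = impulseOp Γ v ω s + if p.1 ≤ s then Γ p.1 (impulseOp Γ v ω) p.2 else 0 := by
  simp only [impulseOp, List.reverse_append, List.reverse_singleton, List.singleton_append]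
  rfl

lemma impulseOp_take {v : List (ℝ × Rd d)} {n : ℕ} (hn : n ≤ v.length) (ω : PathSpace d) (s : ℝ) :
    impulseOp Γ (v.take n) ω s
      = ω.toFun s + ∑ i ∈ Finset.range n, if entryT v i ≤ s then jumpAt Γ v ω i else 0 := by
  induction n with
  | zero => simp [impulseOp, impulseOpAux]
  | succ n ih =>
    rw [List.take_succ_eq_append_getElem hn, impulseOp_append_singleton, ih (by omega),
      getElem_eq_entry hn, Finset.sum_range_succ, add_assoc]
    rfl

lemma impulseOp_eq (v : List (ℝ × Rd d)) (ω : PathSpace d) (s : ℝ) :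
    impulseOp Γ v ω s = ω.toFun s
      + ∑ i ∈ Finset.range v.length, if entryT v i ≤ s then jumpAt Γ v ω i else 0 := by
  simpa using impulseOp_take Γ (le_refl v.length) ω s

lemma measurable_impulseOp (v : List (ℝ × Rd d)) (ω : PathSpace d) :
    Measurable (impulseOp Γ v ω) := by
  rw [funext (impulseOp_eq Γ v ω)]
  refine ω.continuous_toFun.measurable.add (Finset.measurable_sum _ fun i _ => ?_)
  exact Measurable.ite measurableSet_Ici measurable_const measurable_const

lemma exists_norm_impulseOp_le (T : ℝ) (v : List (ℝ × Rd d)) (ω : PathSpace d) :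
    ∃ B, ∀ s ∈ Icc 0 T, ‖impulseOp Γ v ω s‖ ≤ B := by
  obtain ⟨B, hB⟩ := isCompact_Icc.exists_bound_of_continuousOn
    (ω.continuous_toFun.continuousOn (s := Icc 0 T))
  refine ⟨B + ∑ i ∈ Finset.range v.length, ‖jumpAt Γ v ω i‖, fun s hs => ?_⟩
  rw [impulseOp_eq]
  refine (norm_add_le _ _).trans (add_le_add (hB s hs) ?_)
  refine (norm_sum_le _ _).trans (Finset.sum_le_sum fun i _ => ?_)
  split_ifs <;> simp

lemma bddAbove_norm_impulseOp_sub (v v' : List (ℝ × Rd d)) (ω ω' : PathSpace d) {S : Set ℝ}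
    (hS : S ⊆ Icc 0 T) :
    BddAbove ((fun s => ‖impulseOp Γ v ω s - impulseOp Γ v' ω' s‖) '' S) := by
  obtain ⟨B, hB⟩ := exists_norm_impulseOp_le Γ T v ω
  obtain ⟨B', hB'⟩ := exists_norm_impulseOp_le Γ T v' ω'
  refine ⟨B + B', ?_⟩
  rintro _ ⟨s, hs, rfl⟩
  exact (norm_sub_le _ _).trans (add_le_add (hB s (hS hs)) (hB' s (hS hs)))

lemma measurableSet_Upsilon (v v' : List (ℝ × Rd d)) : MeasurableSet (Upsilon v v') :=
  Finset.measurableSet_biUnion _ fun _ _ => measurableSet_Ico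

lemma volume_Upsilon_ne_top (v v' : List (ℝ × Rd d)) : volume (Upsilon v v') ≠ ⊤ :=
  (measure_biUnion_lt_top (Finset.finite_toSet _) fun _ _ => measure_Ico_lt_top).ne

lemma volume_real_Upsilon_le (v v' : List (ℝ × Rd d)) :
    volume.real (Upsilon v v') ≤ seqDist v v' := by
  refine (measureReal_biUnion_finset_le _ _).trans (Finset.sum_le_sum fun j _ => ?_)
  rw [Real.volume_real_Ico_of_le min_le_max, max_sub_min_eq_abs]
  linarith [norm_nonneg (entryB v' j - entryB v j)]

lemma right_notMem_Upsilon {v v' : List (ℝ × Rd d)} (hv : InD T U v) (hv' : InD T U v')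
    (hlen : v.length = v'.length) : T ∉ Upsilon v v' := by
  simp only [Upsilon, mem_iUnion, Finset.mem_range, ← hlen, max_self, mem_Ico, not_exists, not_and,
    not_lt]
  exact fun j hj _ => max_le (hv.entryT_mem hj).2 (hv'.entryT_mem (hlen ▸ hj)).2

/-- The integrals over `[0,T]` of two functions bounded by `C` that are `r`-close off a set `S`
differ by at most `T * r + 2 * C * |S|`. -/
lemma abs_setIntegral_sub_le {T C r : ℝ} (hT : 0 ≤ T) {S : Set ℝ} (hS : MeasurableSet S)
    (hStop : volume S ≠ ⊤) {f g : ℝ → ℝ} (hf : Measurable f) (hg : Measurable g)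
    (hfC : ∀ t, |f t| ≤ C) (hgC : ∀ t, |g t| ≤ C) (hr : 0 ≤ r)
    (hfg : ∀ t ∈ Icc 0 T \ S, |f t - g t| ≤ r) :
    |(∫ t in Icc 0 T, f t) - ∫ t in Icc 0 T, g t| ≤ T * r + 2 * C * volume.real S := by
  have hC : 0 ≤ C := (abs_nonneg _).trans (hfC 0)
  have hint {h : ℝ → ℝ} (hh : Measurable h) (hhC : ∀ t, |h t| ≤ C) :
      IntegrableOn h (Icc 0 T) :=
    Measure.integrableOn_of_bounded (M := C) measure_Icc_lt_top.ne hh.aestronglyMeasurable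
      (Filter.Eventually.of_forall hhC)
  rw [← integral_sub (hint hf hfC) (hint hg hgC),
    ← integral_inter_add_sdiff (f := fun t => f t - g t) hS ((hint hf hfC).sub (hint hg hgC))]
  rw [add_comm, ← Real.norm_eq_abs]
  refine (norm_add_le _ _).trans (add_le_add ?_ ?_)
  · refine (norm_setIntegral_le_of_norm_le_const
      ((measure_mono sdiff_subset).trans_lt measure_Icc_lt_top) hfg).trans ?_
    rw [mul_comm]
    refine mul_le_mul_of_nonneg_right ?_ hr
    refine (measureReal_mono sdiff_subset measure_Icc_lt_top.ne).trans ?_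
    rw [Real.volume_real_Icc_of_le hT, sub_zero]
  · refine (norm_setIntegral_le_of_norm_le_const (C := 2 * C)
      ((measure_mono inter_subset_right).trans_lt hStop.lt_top) fun t _ => ?_).trans ?_
    · refine (norm_sub_le _ _).trans ?_
      rw [two_mul]
      exact add_le_add (hfC t) (hgC t)
    · exact mul_le_mul_of_nonneg_left (measureReal_mono inter_subset_right hStop) (by positivity)

variable {Γ}

/-- The controlled paths of two impulse sequences without their last interventions, evaluated at
the respective last intervention times, differ by at most a multiple of the pseudo-distance. -/
lemma norm_impulseOp_dropLast_sub_le {C : ℝ} (hC : 0 < C)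
    (hΓ : ∀ (t t' : ℝ) (ω ω' : PathSpace d) (v v' : List (ℝ × Rd d)) (b b' : Rd d),
      v.length = v'.length →
        ‖Γ t' (impulseOp Γ v' ω') b' - Γ t (impulseOp Γ v ω) b‖
          ≤ C * (dK T (t, ω, v) (t', ω', v') + ‖b' - b‖))
    (hT : 0 ≤ T) {v v' : List (ℝ × Rd d)} (hv : InD T U v) (hv' : InD T U v')
    (hlen : v.length = v'.length) (ω ω' : PathSpace d) :
    ‖impulseOp Γ v'.dropLast ω' (lastTime v') - impulseOp Γ v.dropLast ω (lastTime v)‖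
      ≤ (1 + v.length * (2 * C)) * dK T (lastTime v, ω, v) (lastTime v', ω', v') := by
  set D := dK T (lastTime v, ω, v) (lastTime v', ω', v') with hD
  have hD0 : 0 ≤ D := dK_nonneg _ _ _ _ _ _
  have hval {w : List (ℝ × Rd d)} (hw : w.length = v.length) (ω : PathSpace d) :
      impulseOp Γ w.dropLast ω (lastTime w)
        = ω.toFun (lastTime w) + ∑ i ∈ Finset.range (v.length - 1), jumpAt Γ w ω i := by
    rw [List.dropLast_eq_take, impulseOp_take Γ (by omega), hw]
    refine congrArg _ (Finset.sum_congr rfl fun i hi => if_pos (entryT_le_lastTime ?_))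
    have := Finset.mem_range.1 hi
    omega
  have hjump : ∀ i ∈ Finset.range (v.length - 1),
      ‖jumpAt Γ v' ω' i - jumpAt Γ v ω i‖ ≤ 2 * C * D := by
    intro i hi
    have hi : i < v.length := by have := Finset.mem_range.1 hi; omega
    refine (hΓ _ _ _ _ _ _ _ _ (by simp [hlen])).trans ?_
    have hpath := dK_take_le hv hv' hlen hi ω ω'
    have hseq := (entry_dist_le_seqDist (v' := v') hi).trans
      (seqDist_le_dK (T := T) (lastTime v) (lastTime v') ω ω' v v')
    have := abs_nonneg (entryT v' i - entryT v i)
    calc C * _ ≤ C * (D + D) := mul_le_mul_of_nonneg_left (by linarith) hC.le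
      _ = 2 * C * D := by ring
  rw [hval hlen.symm, hval rfl, add_sub_add_comm, ← Finset.sum_sub_distrib]
  have hpath := (norm_sub_le_stoppedDist hT (hv.lastTime_le hT) (hv'.lastTime_le hT) ω ω').trans
    (stoppedDist_le_dK (T := T) (lastTime v) (lastTime v') ω ω' v v')
  have hsum : ‖∑ i ∈ Finset.range (v.length - 1), (jumpAt Γ v' ω' i - jumpAt Γ v ω i)‖
      ≤ v.length * (2 * C * D) := by
    refine (norm_sum_le _ _).trans ((Finset.sum_le_sum hjump).trans ?_)
    rw [Finset.sum_const, Finset.card_range, nsmul_eq_mul]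
    exact mul_le_mul_of_nonneg_right (by exact_mod_cast Nat.sub_le _ _) (by positivity)
  calc _ ≤ D + v.length * (2 * C * D) := (norm_add_le _ _).trans (add_le_add hpath hsum)
    _ = _ := by ring

end ImpulseOperator

section Costs

variable {d : ℕ} {T δ : ℝ} {U : Set (Rd d)} {Γ : ℝ → (ℝ → Rd d) → Rd d → Rd d}
  {φt : ℝ → Rd d → ℝ} {ψ : Rd d → ℝ} {ℓ : ℝ → Rd d → Rd d → ℝ}

lemma exists_abs_phiSDE_add_abs_cSDE_le (hrew : RewardAssumptions d T δ U φt ψ ℓ) :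
    ∃ C₀ : ℝ, ∀ (ω : PathSpace d) (v : List (ℝ × Rd d)),
      |phiSDE T Γ φt ψ ω v| + |cSDE Γ ℓ ω v| ≤ C₀ := by
  obtain ⟨Cφ, hφ⟩ := hrew.φt_bdd
  obtain ⟨Cψ, hψ⟩ := hrew.ψ_bdd
  obtain ⟨Cℓ, hℓ⟩ := hrew.ℓ_bdd
  refine ⟨Cφ * volume.real (Icc 0 T) + Cψ + Cℓ, fun ω v => add_le_add ?_ (hℓ _ _ _)⟩
  refine (abs_add_le _ _).trans (add_le_add ?_ (hψ _))
  rw [← Real.norm_eq_abs]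
  exact norm_setIntegral_le_of_norm_le_const measure_Icc_lt_top fun t _ => hφ _ _

lemma exists_modulus_phiSDE (hT : 0 ≤ T) (hrew : RewardAssumptions d T δ U φt ψ ℓ) {κ : ℕ}
    (hstab : ∃ ρ : ℝ → ℝ, IsModulus ρ ∧
      ∀ (v v' : List (ℝ × Rd d)) (ω ω' : PathSpace d),
        InD T U v → InD T U v' → v.length = κ → v'.length = κ →
        supOn (Set.Icc 0 T \ Upsilon v v')
            (fun s => ‖impulseOp Γ v ω s - impulseOp Γ v' ω' s‖)
          ≤ ρ (dK T (T, ω, v) (T, ω', v'))) :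
    ∃ ρ : ℝ → ℝ, IsModulus ρ ∧
      ∀ (ω ω' : PathSpace d) (v v' : List (ℝ × Rd d)),
        InD T U v → InD T U v' → v.length = κ → v'.length = κ →
        |phiSDE T Γ φt ψ ω' v' - phiSDE T Γ φt ψ ω v|
          ≤ ρ (dK T (T, ω, v) (T, ω', v')) := by
  obtain ⟨C, hC⟩ := hrew.φt_bdd
  obtain ⟨ρφ, hρφ, hφ⟩ := hrew.φt_cont
  obtain ⟨ρψ, hρψ, hψ⟩ := hrew.ψ_cont
  obtain ⟨ρX, hρX, hX⟩ := hstab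
  have hC0 : 0 ≤ C := (abs_nonneg _).trans (hC 0 0)
  refine ⟨_, (((hρφ.comp hρX).const_mul hT).add
    (IsModulus.max_zero.const_mul (mul_nonneg zero_le_two hC0))).add (hρψ.comp hρX), ?_⟩
  intro ω ω' v v' hv hv' hl hl'
  set D := dK T (T, ω, v) (T, ω', v') with hD
  have hpath : ∀ s ∈ Icc 0 T \ Upsilon v v',
      ‖impulseOp Γ v' ω' s - impulseOp Γ v ω s‖ ≤ ρX D := fun s hs => by
    rw [norm_sub_rev]
    exact (le_supOn (bddAbove_norm_impulseOp_sub Γ v v' ω ω' sdiff_subset) hs).trans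
      (hX v v' ω ω' hv hv' hl hl')
  have hmeas (w : List (ℝ × Rd d)) (η : PathSpace d) :
      Measurable fun t => φt t (impulseOp Γ w η t) :=
    hrew.φt_meas.comp (measurable_id.prodMk (measurable_impulseOp Γ w η))
  have hrun := abs_setIntegral_sub_le hT (measurableSet_Upsilon v v') (volume_Upsilon_ne_top v v')
    (hmeas v' ω') (hmeas v ω) (fun t => hC _ _) (fun t => hC _ _) (hρφ.2.2.1 (ρX D))
    fun t ht => (hφ _ _ _).trans (hρφ.1 (hpath t ht))
  have hΥ : 2 * C * volume.real (Upsilon v v') ≤ 2 * C * max D 0 :=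
    mul_le_mul_of_nonneg_left ((volume_real_Upsilon_le v v').trans
      ((seqDist_le_dK _ _ _ _ _ _).trans (le_max_left _ _))) (by positivity)
  have hterm := (hψ (impulseOp Γ v ω T) (impulseOp Γ v' ω' T)).trans (hρψ.1 (hpath T
    ⟨right_mem_Icc.2 hT, right_notMem_Upsilon hv hv' (hl.trans hl'.symm)⟩))
  unfold phiSDE
  rw [add_sub_add_comm]
  exact (abs_add_le _ _).trans (add_le_add (hrun.trans (by gcongr)) hterm)

lemma exists_modulus_cSDE (hT : 0 ≤ T) (hrew : RewardAssumptions d T δ U φt ψ ℓ)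
    (hΓ : ∃ C : ℝ, 0 < C ∧
      ∀ (t t' : ℝ) (ω ω' : PathSpace d) (v v' : List (ℝ × Rd d)) (b b' : Rd d),
        v.length = v'.length →
          ‖Γ t' (impulseOp Γ v' ω') b' - Γ t (impulseOp Γ v ω) b‖
            ≤ C * (dK T (t, ω, v) (t', ω', v') + ‖b' - b‖)) (κ : ℕ) :
    ∃ ρ : ℝ → ℝ, IsModulus ρ ∧
      ∀ (ω ω' : PathSpace d) (v v' : List (ℝ × Rd d)),
        InD T U v → InD T U v' → v.length = κ → v'.length = κ →
        |cSDE Γ ℓ ω' v' - cSDE Γ ℓ ω v|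
          ≤ ρ (dK T (lastTime v, ω, v) (lastTime v', ω', v')) := by
  obtain ⟨C, hC, hΓ⟩ := hΓ
  obtain ⟨ρℓ, hρℓ, hℓ⟩ := hrew.ℓ_cont
  have hfac : 0 ≤ 2 + κ * (2 * C) := by positivity
  refine ⟨_, hρℓ.comp (IsModulus.max_zero.const_mul hfac), ?_⟩
  intro ω ω' v v' hv hv' hl hl'
  refine (hℓ _ _ _ _ _ _).trans (hρℓ.1 ?_)
  have hpath := norm_impulseOp_dropLast_sub_le hC hΓ hT hv hv' (hl.trans hl'.symm) ω ω'
  set D := dK T (lastTime v, ω, v) (lastTime v', ω', v') with hD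
  have hlast : |lastTime v' - lastTime v|
      + ‖entryB v' (v'.length - 1) - entryB v (v.length - 1)‖ ≤ D := by
    rcases Nat.eq_zero_or_pos κ with rfl | hκ
    · obtain rfl := List.length_eq_zero_iff.1 hl
      obtain rfl := List.length_eq_zero_iff.1 hl'
      simpa using dK_nonneg _ _ _ _ _ _
    · rw [hv.lastTime_eq (hl ▸ hκ), hv'.lastTime_eq (hl' ▸ hκ), hl, hl']
      exact (entry_dist_le_seqDist (by omega)).trans (seqDist_le_dK _ _ _ _ _ _)
  rw [hl] at hpath
  calc _ ≤ (2 + κ * (2 * C)) * D := by linarith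
    _ ≤ _ := mul_le_mul_of_nonneg_left (le_max_left _ _) hfac

/-- The path `ω` stopped at time `t`, as a continuous map on `[0,T]`. -/
noncomputable def stoppedPath (T t : ℝ) (ω : PathSpace d) : C(Icc (0 : ℝ) T, Rd d) where
  toFun s := ω.toFun (min s t)
  continuous_toFun := ω.continuous_toFun.comp (continuous_subtype_val.min continuous_const)

lemma measurable_stoppedPath_apply (t : ℝ) (s : Icc (0 : ℝ) T) :
    Measurable[Filt d t] fun ω => stoppedPath T t ω s :=
  (measurable_pi_apply (s : ℝ)).comp
    (comap_measurable fun (ω : PathSpace d) (s : ℝ) => ω.toFun (min s t))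

lemma stoppedDist_le_dist_stoppedPath (hT : 0 ≤ T) {r t : ℝ} (hr : 0 ≤ r) (hrt : r ≤ t)
    (ω ω' : PathSpace d) :
    stoppedDist T r r ω ω' ≤ dist (stoppedPath T t ω') (stoppedPath T t ω) := by
  refine supOn_le (nonempty_Icc.2 hT) fun s hs => ?_
  have h := ContinuousMap.dist_apply_le_dist (f := stoppedPath T t ω') (g := stoppedPath T t ω)
    ⟨min s r, le_min hs.1 hr, (min_le_left _ _).trans hs.2⟩
  rw [dist_eq_norm] at h
  simpa only [stoppedPath, ContinuousMap.coe_mk, min_assoc, min_eq_left hrt] using h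

lemma dK_self_le_dist_stoppedPath (hT : 0 ≤ T) {v : List (ℝ × Rd d)} (hv : InD T U v)
    (ω ω' : PathSpace d) :
    dK T (lastTime v, ω, v) (lastTime v, ω', v) ≤ (1 + v.length)
      * dist (stoppedPath T (lastTime v) ω') (stoppedPath T (lastTime v) ω) := by
  have hsum := Finset.sum_le_sum fun j (hj : j ∈ Finset.range v.length) =>
    stoppedDist_le_dist_stoppedPath hT
      (le_min (hv.entryT_mem (Finset.mem_range.1 hj)).1 (lastTime_nonneg v))
      (min_le_right (entryT v j) _) ω ω'
  rw [Finset.sum_const, Finset.card_range, nsmul_eq_mul] at hsum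
  have hseq : seqDist v v = 0 := by simp [seqDist]
  rw [dK_eq, hseq, add_zero, add_mul, one_mul]
  exact add_le_add (stoppedDist_le_dist_stoppedPath hT (lastTime_nonneg v) le_rfl _ _) hsum

/-- A function of the path that is uniformly continuous in the pseudo-distance up to the last
intervention time of `v` is measurable with respect to the information at that time. -/
lemma measurable_of_abs_sub_le_dK (hT : 0 ≤ T) {v : List (ℝ × Rd d)} (hv : InD T U v)
    {ρ : ℝ → ℝ} (hρ : IsModulus ρ) {f : PathSpace d → ℝ}
    (hf : ∀ ω ω', |f ω' - f ω| ≤ ρ (dK T (lastTime v, ω, v) (lastTime v, ω', v))) :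
    Measurable[Filt d (lastTime v)] f := by
  have hfac : (0 : ℝ) ≤ 1 + v.length := by positivity
  have : Nonempty (Icc (0 : ℝ) T) := (nonempty_Icc.2 hT).to_subtype
  refine measurable_of_abs_sub_le_modulus (m := Filt d (lastTime v))
    (Φ := stoppedPath T (lastTime v)) (measurable_stoppedPath_apply _)
    (hρ.comp (IsModulus.max_zero.const_mul hfac)) fun ω ω' => (hf ω ω').trans (hρ.1 ?_)
  rw [max_eq_left dist_nonneg]
  exact dK_self_le_dist_stoppedPath hT hv ω ω'

end Costs

/-- Lemma 6.4, the SDE costs satisfy Assumption 3.  With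
`φ(ω,v) := ∫_0^T φ̃(t,(𝓘^v(ω))_t) dt + ψ((𝓘^v(ω))_T)` and
`c(ω,(t_i,b_i)_{i=1}^j) := ℓ(t_j,(𝓘^{(t_i,b_i)_{i<j}}(ω))_{t_j}, b_j)`, the pair
`(φ,c)` is uniformly bounded, for each `κ` uniformly continuous on `Ω×D^κ` with
respect to `d_κ`, satisfies `c ≥ δ > 0`, and `c(·,(t_i,b_i)_{i=1}^j)` is
`F_{t_j}`-measurable. -/
theorem sde_costs_satisfy_assumption3
    (d : ℕ) (T : ℝ) (hT : 0 < T) (U : Set (Rd d)) (hUcomp : IsCompact U)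
    (Γ : ℝ → (ℝ → Rd d) → Rd d → Rd d)
    (φt : ℝ → Rd d → ℝ) (ψ : Rd d → ℝ) (ℓ : ℝ → Rd d → Rd d → ℝ) (δ : ℝ)
    (hrew : RewardAssumptions d T δ U φt ψ ℓ)
    -- Assumption 6(i) for `Γ` along the continuous-part / jump decomposition
    (hΓ : ∃ C : ℝ, 0 < C ∧
      ∀ (t t' : ℝ) (ω ω' : PathSpace d) (v v' : List (ℝ × Rd d)) (b b' : Rd d),
        v.length = v'.length →
          ‖Γ t' (impulseOp Γ v' ω') b' - Γ t (impulseOp Γ v ω) b‖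
            ≤ C * (dK T (t, ω, v) (t', ω', v') + ‖b' - b‖))
    -- the stability estimate of Proposition 6.3 for the impulse operator
    (hstab : ∀ k : ℕ, ∃ ρ : ℝ → ℝ, IsModulus ρ ∧
      ∀ (v v' : List (ℝ × Rd d)) (ω ω' : PathSpace d),
        InD T U v → InD T U v' → v.length = k → v'.length = k →
        supOn (Set.Icc 0 T \ Upsilon v v')
            (fun s => ‖impulseOp Γ v ω s - impulseOp Γ v' ω' s‖)
          ≤ ρ (dK T (T, ω, v) (T, ω', v'))) :
    -- uniform boundedness
    (∃ C₀ : ℝ, ∀ (ω : PathSpace d) (v : List (ℝ × Rd d)), InD T U v →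
        |phiSDE T Γ φt ψ ω v| + |cSDE Γ ℓ ω v| ≤ C₀) ∧
    -- uniform continuity of `φ` on `Ω × D^κ` with respect to `d_κ`
    (∀ κ : ℕ, ∃ ρ : ℝ → ℝ, IsModulus ρ ∧
      ∀ (ω ω' : PathSpace d) (v v' : List (ℝ × Rd d)),
        InD T U v → InD T U v' → v.length = κ → v'.length = κ →
        (∀ j, j < κ → entryT v j ≤ entryT v' j) →
        |phiSDE T Γ φt ψ ω' v' - phiSDE T Γ φt ψ ω v|
          ≤ ρ (dK T (T, ω, v) (T, ω', v'))) ∧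
    -- uniform continuity of `c` on `Ω × D^κ` with respect to `d_κ`
    (∀ κ : ℕ, ∃ ρ : ℝ → ℝ, IsModulus ρ ∧
      ∀ (ω ω' : PathSpace d) (v v' : List (ℝ × Rd d)),
        InD T U v → InD T U v' → v.length = κ → v'.length = κ →
        |cSDE Γ ℓ ω' v' - cSDE Γ ℓ ω v|
          ≤ ρ (dK T (lastTime v, ω, v) (lastTime v', ω', v'))) ∧
    -- `c ≥ δ > 0`
    (∀ (ω : PathSpace d) (v : List (ℝ × Rd d)), InD T U v → δ ≤ cSDE Γ ℓ ω v) ∧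
    -- `c(·,(t_i,b_i)_{i=1}^j)` is `F_{t_j}`-measurable
    (∀ v : List (ℝ × Rd d), InD T U v →
        Measurable[Filt d (lastTime v)] fun ω => cSDE Γ ℓ ω v) := by
  obtain ⟨C₀, hC₀⟩ := exists_abs_phiSDE_add_abs_cSDE_le (Γ := Γ) hrew
  have hc := exists_modulus_cSDE hT.le hrew hΓ
  refine ⟨⟨C₀, fun ω v _ => hC₀ ω v⟩, fun κ => ?_, hc, fun ω v _ => hrew.ℓ_lower _ _ _,
    fun v hv => ?_⟩
  · obtain ⟨ρ, hρ, hφ⟩ := exists_modulus_phiSDE hT.le hrew (hstab κ)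
    exact ⟨ρ, hρ, fun ω ω' v v' hv hv' hl hl' _ => hφ ω ω' v v' hv hv' hl hl'⟩
  · obtain ⟨ρ, hρ, hcρ⟩ := hc v.length
    exact measurable_of_abs_sub_le_dK hT.le hv hρ fun ω ω' => hcρ ω ω' v v hv hv rfl rfl
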